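/- arXiv:math/0609563 — 2 statements merged into one kernel-verified Lean document; each statement's English description precedes it below -/
import Mathlib

section
/- For every n ≥ 3, the groups H_n and VP_n are not isomorphic. (Indeed, the abelianization of VP_n is isomorphic to ℤ^{n(n−1)}, while the abelianization of H_n is isomorphic to ℤ ⊕ ℤ for n = 3 and to ℤ for n ≥ 4.) -/
/-- The free-group letter corresponding to the braid generator `σ_{i+1}`
(0-based index `i`) of the virtual braid group on `n` strands. -/
def σg (n : ℕ) (i : Fin (n-1)) : FreeGroup (Fin (n-1) ⊕ Fin (n-1)) := FreeGroup.of (Sum.inl i)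

/-- The free-group letter corresponding to the virtual generator `ρ_{i+1}`
(0-based index `i`) of the virtual braid group on `n` strands. -/
def ρg (n : ℕ) (i : Fin (n-1)) : FreeGroup (Fin (n-1) ⊕ Fin (n-1)) := FreeGroup.of (Sum.inr i)

/-- The defining relators of the virtual braid group `VB n`. -/
def vbRels (n : ℕ) : Set (FreeGroup (Fin (n-1) ⊕ Fin (n-1))) :=
  {r | ∃ i j : Fin (n-1),
    ((i:ℕ)+1 = (j:ℕ) ∧ r = σg n i * σg n j * σg n i * (σg n j * σg n i * σg n j)⁻¹) ∨
    (((i:ℕ)+2 ≤ (j:ℕ) ∨ (j:ℕ)+2 ≤ (i:ℕ)) ∧ r = σg n i * σg n j * (σg n j * σg n i)⁻¹) ∨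
    ((i:ℕ)+1 = (j:ℕ) ∧ r = ρg n i * ρg n j * ρg n i * (ρg n j * ρg n i * ρg n j)⁻¹) ∨
    (((i:ℕ)+2 ≤ (j:ℕ) ∨ (j:ℕ)+2 ≤ (i:ℕ)) ∧ r = ρg n i * ρg n j * (ρg n j * ρg n i)⁻¹) ∨
    (r = ρg n i * ρg n i) ∨
    (((i:ℕ)+2 ≤ (j:ℕ) ∨ (j:ℕ)+2 ≤ (i:ℕ)) ∧ r = σg n i * ρg n j * (ρg n j * σg n i)⁻¹) ∨
    ((i:ℕ)+1 = (j:ℕ) ∧ r = ρg n i * ρg n j * σg n i * (σg n j * ρg n i * ρg n j)⁻¹)}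

/-- The virtual braid group on `n` strands, given by its standard presentation. -/
abbrev VB (n : ℕ) : Type := PresentedGroup (vbRels n)

/-- The generator `σ_{i+1}` of `VB n`. -/
def σv (n : ℕ) (i : Fin (n-1)) : VB n := PresentedGroup.of (Sum.inl i)

/-- The generator `ρ_{i+1}` of `VB n`. -/
def ρv (n : ℕ) (i : Fin (n-1)) : VB n := PresentedGroup.of (Sum.inr i)

/-- The transposition `(i+1, i+2)` (0-based: swapping `i` and `i+1`) in `S_n`. -/
def sw (n : ℕ) (i : Fin (n-1)) : Equiv.Perm (Fin n) :=
  Equiv.swap ⟨i.val, by have := i.isLt; omega⟩ ⟨i.val + 1, by have := i.isLt; omega⟩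

/-- `μ : VB n → S_n` sends each `σ_i` to `1` and each `ρ_i` to the transposition `(i, i+1)`.
Its kernel is the normal closure `H_n` of the braid group `B_n` in `VB n`. -/
def IsMu (n : ℕ) (μ : VB n →* Equiv.Perm (Fin n)) : Prop :=
  ∀ i : Fin (n-1), μ (σv n i) = 1 ∧ μ (ρv n i) = sw n i

/-- `ν : VB n → S_n` sends both `σ_i` and `ρ_i` to the transposition `(i, i+1)`.
Its kernel is the virtual pure braid group `VP_n`. -/
def IsNu (n : ℕ) (ν : VB n →* Equiv.Perm (Fin n)) : Prop :=
  ∀ i : Fin (n-1), ν (σv n i) = sw n i ∧ ν (ρv n i) = sw n i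

section SymmetricGroupPresentation

variable {G : Type*} [Group G]

/-- The descending product `s k * s (k - 1) * ⋯` with `l` factors. -/
def descProd (s : ℕ → G) (k : ℕ) : ℕ → G
  | 0 => 1
  | l + 1 => descProd s k l * s (k - l)

/-- The relations of the Coxeter presentation of the symmetric group, for the generators
`s 0, …, s (m - 1)`. -/
structure IsSymmetricRelations (s : ℕ → G) (m : ℕ) : Prop where
  mul_self : ∀ i < m, s i * s i = 1
  braid : ∀ i, i + 1 < m → s i * s (i + 1) * s i = s (i + 1) * s i * s (i + 1)
  comm : ∀ i j, i + 2 ≤ j → j < m → s i * s j = s j * s i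

namespace IsSymmetricRelations

variable {s : ℕ → G} {m : ℕ}

lemma descProd_mul_of_lt (hs : IsSymmetricRelations s m) {k : ℕ} (hk : k < m) {i l : ℕ}
    (h : i + l < k) : descProd s k l * s i = s i * descProd s k l := by
  induction l with
  | zero => simp [descProd]
  | succ l ih =>
    rw [descProd, mul_assoc, ← hs.comm i (k - l) (by omega) (by omega), ← mul_assoc,
      ih (by omega), mul_assoc]

lemma descProd_mul_of_gt (hs : IsSymmetricRelations s m) {k : ℕ} (hk : k < m) {i l : ℕ}
    (hl : l ≤ k + 1) (hi : i + 1 ≤ k) (h : k < i + l) :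
    descProd s k l * s (i + 1) = s i * descProd s k l := by
  induction l with
  | zero => omega
  | succ l ih =>
    rcases Nat.lt_or_ge k (i + l) with h' | h'
    · rw [descProd, mul_assoc, hs.comm (k - l) (i + 1) (by omega) (by omega), ← mul_assoc,
        ih (by omega) h', mul_assoc]
    · obtain ⟨l, rfl⟩ : ∃ l', l = l' + 1 := ⟨l - 1, by omega⟩
      have h₁ : k - l = i + 1 := by omega
      have h₂ : k - (l + 1) = i := by omega
      have hc := hs.descProd_mul_of_lt hk (i := i) (l := l) (by omega)
      simp only [descProd, h₁, h₂]
      calc descProd s k l * s (i + 1) * s i * s (i + 1)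
          = descProd s k l * (s (i + 1) * s i * s (i + 1)) := by group
        _ = (descProd s k l * s i) * s (i + 1) * s i := by
            rw [← hs.braid i (by omega)]; group
        _ = s i * (descProd s k l * s (i + 1) * s i) := by rw [hc]; group

lemma exists_mul_descProd (hs : IsSymmetricRelations s m) {k : ℕ} (hk : k < m) {w : G}
    (hw : w ∈ Subgroup.closure (s '' Set.Iio (k + 1))) :
    ∃ v ∈ Subgroup.closure (s '' Set.Iio k), ∃ l ≤ k + 1, w = v * descProd s k l := by
  have step : ∀ x i, i < k + 1 →
      (∃ v ∈ Subgroup.closure (s '' Set.Iio k), ∃ l ≤ k + 1, x = v * descProd s k l) →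
      ∃ v ∈ Subgroup.closure (s '' Set.Iio k), ∃ l ≤ k + 1, x * s i = v * descProd s k l := by
    rintro _ i hi ⟨v, hv, l, hl, rfl⟩
    have mem : ∀ j < k, s j ∈ Subgroup.closure (s '' Set.Iio k) := fun j hj =>
      Subgroup.subset_closure ⟨j, hj, rfl⟩
    rcases lt_trichotomy (i + l) k with h | h | h
    · exact ⟨v * s i, mul_mem hv (mem i (by omega)), l, hl, by
        rw [mul_assoc, hs.descProd_mul_of_lt hk h, mul_assoc]⟩
    · refine ⟨v, hv, l + 1, by omega, ?_⟩
      rw [descProd, show k - l = i by omega, mul_assoc]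
    · rcases Nat.lt_or_ge (k + 1) (i + l) with h' | h'
      · obtain ⟨i, rfl⟩ : ∃ i', i = i' + 1 := ⟨i - 1, by omega⟩
        exact ⟨v * s i, mul_mem hv (mem i (by omega)), l, hl, by
          rw [mul_assoc, hs.descProd_mul_of_gt hk hl (by omega) (by omega), mul_assoc]⟩
      · obtain ⟨l, rfl⟩ : ∃ l', l = l' + 1 := ⟨l - 1, by omega⟩
        refine ⟨v, hv, l, by omega, ?_⟩
        rw [descProd, show k - l = i by omega, mul_assoc, mul_assoc, hs.mul_self i (by omega),
          mul_one]
  induction hw using Subgroup.closure_induction_right with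
  | one => exact ⟨1, one_mem _, 0, by omega, by simp [descProd]⟩
  | mul_right x y _ hy ih =>
    obtain ⟨i, hi, rfl⟩ := hy
    exact step x i hi ih
  | mul_inv_cancel x y _ hy ih =>
    obtain ⟨i, hi, rfl⟩ := hy
    rw [inv_eq_of_mul_eq_one_right (hs.mul_self i (by have : i < k + 1 := hi; omega))]
    exact step x i hi ih

/-- A homomorphism sending the generators to adjacent transpositions is injective on the subgroup
that they generate. -/
lemma eq_one_of_map_eq_one (hs : IsSymmetricRelations s m) {X : Type*} [DecidableEq X]
    {p : ℕ → X} (hp : Set.InjOn p (Set.Iic m)) (f : G →* Equiv.Perm X)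
    (hf : ∀ i < m, f (s i) = Equiv.swap (p i) (p (i + 1))) {k : ℕ} (hk : k ≤ m) {w : G}
    (hw : w ∈ Subgroup.closure (s '' Set.Iio k)) (h : f w = 1) : w = 1 := by
  induction k generalizing w with
  | zero => simpa using hw
  | succ k ih =>
    have hfix : ∀ v ∈ Subgroup.closure (s '' Set.Iio k), f v (p (k + 1)) = p (k + 1) := by
      intro v hv
      suffices hle : Subgroup.closure (s '' Set.Iio k) ≤
          (MulAction.stabilizer (Equiv.Perm X) (p (k + 1))).comap f from hle hv
      rw [Subgroup.closure_le]
      rintro _ ⟨i, hi, rfl⟩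
      have hi : i < k := hi
      have hne : ∀ j ≤ k, p (k + 1) ≠ p j := fun j hj he => by
        have := hp (Set.mem_Iic.2 hk) (Set.mem_Iic.2 (show j ≤ m by omega)) he
        omega
      change f (s i) (p (k + 1)) = p (k + 1)
      rw [hf i (by omega), Equiv.swap_apply_of_ne_of_ne (hne _ (by omega)) (hne _ (by omega))]
    have hcyc : ∀ l ≤ k + 1, f (descProd s k l) (p (k + 1 - l)) = p (k + 1) := by
      intro l hl
      induction l with
      | zero => simp [descProd]
      | succ l ihl =>
        rw [descProd, map_mul, Equiv.Perm.mul_apply, hf _ (by omega),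
          show k + 1 - (l + 1) = k - l by omega, Equiv.swap_apply_left,
          show k - l + 1 = k + 1 - l by omega, ihl (by omega)]
    obtain ⟨v, hv, l, hl, rfl⟩ := hs.exists_mul_descProd (by omega) hw
    have he : p (k + 1 - l) = p (k + 1) := by
      have := congrArg (fun e : Equiv.Perm X => e (p (k + 1 - l))) h
      simpa [hcyc l hl, hfix v hv] using this.symm
    have : l = 0 := by
      have := hp (show k + 1 - l ∈ Set.Iic m from (by omega : k + 1 - l ≤ m)) hk he
      omega
    subst this
    simp only [descProd, mul_one] at h ⊢
    exact ih (by omega) hv h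

end IsSymmetricRelations

end SymmetricGroupPresentation

lemma eq_of_forall_succ_eq {α : Type*} {k : ℕ} {F : Fin k → α}
    (h : ∀ i j : Fin k, (i : ℕ) + 1 = j → F i = F j) (i j : Fin k) : F i = F j := by
  have key : ∀ (d : ℕ) (i j : Fin k), (i : ℕ) + d = j → F i = F j := by
    intro d
    induction d with
    | zero => intro i j hij; rw [Fin.ext (show (i : ℕ) = j by simpa using hij)]
    | succ d ih =>
      intro i j hij
      exact (h i ⟨i + 1, by omega⟩ rfl).trans (ih _ j (by simp; omega))
  rcases le_total (i : ℕ) j with hij | hij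
  · exact key (j - i) i j (by omega)
  · exact (key (i - j) j i (by omega)).symm

section MixedRelations

variable {G : Type*} [Group G] {H : Subgroup G} [H.Normal] {A : Type*} [CommGroup A] {k : ℕ}

/-- The relations between adjacent generators `x i`, `r i` of the virtual braid group, with the
`x i` lying in a given subgroup. -/
structure IsVirtualBraidLike (x : Fin k → H) (r : Fin k → G) : Prop where
  mul_self : ∀ i, r i * r i = 1
  braid : ∀ i j : Fin k, (i : ℕ) + 1 = j → x i * x j * x i = x j * x i * x j
  mixed : ∀ i j : Fin k, (i : ℕ) + 1 = j → MulAut.conjNormal (r i * r j) (x i) = x j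

lemma map_conjNormal_mul_coe (f : H →* A) (w : G) (h y : H) :
    f (MulAut.conjNormal (w * h) y) = f (MulAut.conjNormal w y) := by
  have : MulAut.conjNormal (h : G) y = h * y * h⁻¹ := by ext; simp
  rw [map_mul, MulAut.mul_apply, this]
  simp only [map_mul, map_inv]
  exact mul_inv_cancel_comm _ _

namespace IsVirtualBraidLike

variable {x : Fin k → H} {r : Fin k → G}

lemma map_conjNormal_eq (hx : IsVirtualBraidLike x r) (f : H →* A) (w : G) (i j : Fin k) :
    f (MulAut.conjNormal w (x i)) = f (MulAut.conjNormal w (x j)) := by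
  refine eq_of_forall_succ_eq (F := fun i => f (MulAut.conjNormal w (x i))) ?_ i j
  intro i j hij
  have h := congrArg (fun y => f (MulAut.conjNormal w y)) (hx.braid i j hij)
  simp only [map_mul] at h
  rw [mul_comm (f (MulAut.conjNormal w (x j))) (f (MulAut.conjNormal w (x i)))] at h
  exact mul_left_cancel h

lemma map_conjNormal_mul_eq (hx : IsVirtualBraidLike x r) (f : H →* A) (w : G) (a i j : Fin k) :
    f (MulAut.conjNormal (w * r i) (x a)) = f (MulAut.conjNormal (w * r j) (x a)) := by
  refine eq_of_forall_succ_eq (F := fun i => f (MulAut.conjNormal (w * r i) (x a))) ?_ i j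
  intro i j hij
  have h : f (MulAut.conjNormal (w * r i * (r i * r j)) (x i)) =
      f (MulAut.conjNormal (w * r i) (x j)) := by
    rw [map_mul _ (w * r i), MulAut.mul_apply, hx.mixed i j hij]
  rw [mul_assoc w, ← mul_assoc (r i), hx.mul_self, one_mul] at h
  rw [hx.map_conjNormal_eq f _ a j, ← h, hx.map_conjNormal_eq f _ i a]

lemma map_conjNormal_ext (hx : IsVirtualBraidLike x r)
    (hgen : Subgroup.closure (Set.range (fun i => (x i : G)) ∪ Set.range r) = ⊤)
    {f g : H →* A} {a : Fin k} (h₁ : f (x a) = g (x a))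
    (h₂ : f (MulAut.conjNormal (r a) (x a)) = g (MulAut.conjNormal (r a) (x a)))
    (w : G) (i : Fin k) :
    f (MulAut.conjNormal w (x i)) = g (MulAut.conjNormal w (x i)) := by
  suffices key : f (MulAut.conjNormal w (x a)) = g (MulAut.conjNormal w (x a)) ∧
      f (MulAut.conjNormal (w * r a) (x a)) = g (MulAut.conjNormal (w * r a) (x a)) by
    rw [hx.map_conjNormal_eq f w i a, hx.map_conjNormal_eq g w i a, key.1]
  have hstep_r : ∀ (e : H →* A) (w : G) (i : Fin k),
      e (MulAut.conjNormal (w * r i * r a) (x a)) = e (MulAut.conjNormal w (x a)) := by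
    intro e w i
    rw [hx.map_conjNormal_mul_eq e _ a a i, mul_assoc, hx.mul_self, mul_one]
  have hstep_x : ∀ (e : H →* A) (w : G) (y : H),
      e (MulAut.conjNormal (w * y * r a) (x a)) = e (MulAut.conjNormal (w * r a) (x a)) := by
    intro e w y
    rw [← map_conjNormal_mul_coe e (w * r a) (MulAut.conjNormal (r a)⁻¹ y)]
    congr 3
    simp [mul_assoc]
  have hw : w ∈ Subgroup.closure (Set.range (fun i => (x i : G)) ∪ Set.range r) :=
    hgen ▸ Subgroup.mem_top w
  induction hw using Subgroup.closure_induction_right with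
  | one => simpa using ⟨h₁, h₂⟩
  | mul_right w y _ hy ih =>
    rcases hy with ⟨i, rfl⟩ | ⟨i, rfl⟩
    · simp only [hstep_x, map_conjNormal_mul_coe]
      exact ih
    · simp only [hstep_r]
      rw [hx.map_conjNormal_mul_eq f w a i a, hx.map_conjNormal_mul_eq g w a i a]
      exact ih.symm
  | mul_inv_cancel w y _ hy ih =>
    rcases hy with ⟨i, rfl⟩ | ⟨i, rfl⟩
    · simp only [← InvMemClass.coe_inv, hstep_x, map_conjNormal_mul_coe]
      exact ih
    · rw [inv_eq_of_mul_eq_one_right (hx.mul_self i)]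
      simp only [hstep_r]
      rw [hx.map_conjNormal_mul_eq f w a i a, hx.map_conjNormal_mul_eq g w a i a]
      exact ih.symm

lemma hom_ext (hx : IsVirtualBraidLike x r)
    (hgen : Subgroup.closure (Set.range (fun i => (x i : G)) ∪ Set.range r) = ⊤)
    (hH : H ≤ Subgroup.normalClosure (Set.range fun i => (x i : G)))
    {f g : H →* A} {a : Fin k} (h₁ : f (x a) = g (x a))
    (h₂ : f (MulAut.conjNormal (r a) (x a)) = g (MulAut.conjNormal (r a) (x a))) : f = g := by
  have hle : Subgroup.normalClosure (Set.range fun i => (x i : G)) ≤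
      (f.eqLocus g).map H.subtype := by
    rw [Subgroup.normalClosure, Subgroup.closure_le]
    intro y hy
    obtain ⟨_, ⟨i, rfl⟩, hy⟩ := Group.mem_conjugatesOfSet_iff.1 hy
    obtain ⟨c, rfl⟩ := isConj_iff.1 hy
    exact ⟨MulAut.conjNormal c (x i), hx.map_conjNormal_ext hgen h₁ h₂ c i, by simp⟩
  ext y
  obtain ⟨z, hz, hzy⟩ := hle (hH y.2)
  obtain rfl : z = y := Subtype.ext hzy
  exact hz

end IsVirtualBraidLike

end MixedRelations

section VirtualBraid

variable {n : ℕ}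

lemma ρv_mul_self (i : Fin (n - 1)) : ρv n i * ρv n i = 1 :=
  PresentedGroup.one_of_mem (rels := vbRels n) (x := ρg n i * ρg n i) ⟨i, i, by simp⟩

lemma σv_braid {i j : Fin (n - 1)} (h : (i : ℕ) + 1 = j) :
    σv n i * σv n j * σv n i = σv n j * σv n i * σv n j :=
  PresentedGroup.mk_eq_mk_of_mul_inv_mem (rels := vbRels n)
    (x := σg n i * σg n j * σg n i) (y := σg n j * σg n i * σg n j) ⟨i, j, by simp [h]⟩

lemma ρv_braid {i j : Fin (n - 1)} (h : (i : ℕ) + 1 = j) :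
    ρv n i * ρv n j * ρv n i = ρv n j * ρv n i * ρv n j :=
  PresentedGroup.mk_eq_mk_of_mul_inv_mem (rels := vbRels n)
    (x := ρg n i * ρg n j * ρg n i) (y := ρg n j * ρg n i * ρg n j) ⟨i, j, by simp [h]⟩

lemma ρv_comm {i j : Fin (n - 1)} (h : (i : ℕ) + 2 ≤ j) :
    ρv n i * ρv n j = ρv n j * ρv n i :=
  PresentedGroup.mk_eq_mk_of_mul_inv_mem (rels := vbRels n)
    (x := ρg n i * ρg n j) (y := ρg n j * ρg n i) ⟨i, j, by simp [h]⟩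

lemma ρv_mul_ρv_mul_σv {i j : Fin (n - 1)} (h : (i : ℕ) + 1 = j) :
    ρv n i * ρv n j * σv n i = σv n j * ρv n i * ρv n j :=
  PresentedGroup.mk_eq_mk_of_mul_inv_mem (rels := vbRels n)
    (x := ρg n i * ρg n j * σg n i) (y := σg n j * ρg n i * ρg n j) ⟨i, j, by simp [h]⟩

lemma closure_range_σv_union_range_ρv :
    Subgroup.closure (Set.range (σv n) ∪ Set.range (ρv n)) = ⊤ := by
  rw [← PresentedGroup.closure_range_of (vbRels n), Set.range_eq_iUnion (PresentedGroup.of)]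
  congr 1
  ext y
  simp [σv, ρv, eq_comm]

lemma eq_one_of_mem_closure_range_ρv (hn : 1 ≤ n) (f : VB n →* Equiv.Perm (Fin n))
    (hf : ∀ i, f (ρv n i) = sw n i) {w : VB n} (hw : w ∈ Subgroup.closure (Set.range (ρv n)))
    (h : f w = 1) : w = 1 := by
  let s : ℕ → VB n := fun i => if h : i < n - 1 then ρv n ⟨i, h⟩ else 1
  let p : ℕ → Fin n := fun i => ⟨min i (n - 1), by omega⟩
  have hs : IsSymmetricRelations s (n - 1) := by
    refine ⟨fun i hi => ?_, fun i hi => ?_, fun i j hij hj => ?_⟩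
    · simp only [s, dif_pos hi]
      exact ρv_mul_self _
    · simp only [s, dif_pos hi, dif_pos (show i < n - 1 by omega)]
      exact ρv_braid rfl
    · simp only [s, dif_pos hj, dif_pos (show i < n - 1 by omega)]
      exact ρv_comm hij
  refine hs.eq_one_of_map_eq_one (p := p) ?_ f ?_ le_rfl ?_ h
  · intro i hi j hj hij
    simp only [Set.mem_Iic, p, Fin.mk.injEq] at hi hj hij
    omega
  · intro i hi
    simp only [s, dif_pos hi, hf, sw, p]
    congr 2 <;> omega
  · convert hw using 2
    ext y
    constructor
    · rintro ⟨i, hi, rfl⟩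
      exact ⟨⟨i, hi⟩, by simp only [s, dif_pos (show i < n - 1 from hi)]⟩
    · rintro ⟨i, rfl⟩
      exact ⟨i, i.2, dif_pos i.2⟩

lemma IsMu.ker_le_normalClosure (hn : 1 ≤ n) {μ : VB n →* Equiv.Perm (Fin n)} (hμ : IsMu n μ) :
    μ.ker ≤ Subgroup.normalClosure (Set.range (σv n)) := by
  have hN : Subgroup.normalClosure (Set.range (σv n)) ≤ μ.ker :=
    Subgroup.normalClosure_le_normal (by rintro _ ⟨i, rfl⟩; exact (hμ i).1)
  intro y hy
  have htop : y ∈ Subgroup.normalClosure (Set.range (σv n)) ⊔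
      Subgroup.closure (Set.range (ρv n)) := by
    suffices hle : ⊤ ≤ Subgroup.normalClosure (Set.range (σv n)) ⊔
        Subgroup.closure (Set.range (ρv n)) from hle (Subgroup.mem_top y)
    rw [← closure_range_σv_union_range_ρv, Subgroup.closure_union]
    exact sup_le_sup_right Subgroup.closure_le_normalClosure _
  obtain ⟨a, ha, w, hw, rfl⟩ := Subgroup.mem_sup_of_normal_left.1 htop
  have : w = 1 := eq_one_of_mem_closure_range_ρv hn μ (fun i => (hμ i).2) hw (by
    have h₁ : μ a = 1 := hN ha
    have h₂ : μ (a * w) = 1 := hy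
    simpa [h₁] using h₂)
  simpa [this] using ha

lemma IsMu.hom_ext {A : Type*} [CommGroup A] {μ : VB n →* Equiv.Perm (Fin n)} (hμ : IsMu n μ)
    (a : Fin (n - 1)) {f g : μ.ker →* A}
    (h₁ : f ⟨σv n a, (hμ a).1⟩ = g ⟨σv n a, (hμ a).1⟩)
    (h₂ : f (MulAut.conjNormal (ρv n a) ⟨σv n a, (hμ a).1⟩) =
      g (MulAut.conjNormal (ρv n a) ⟨σv n a, (hμ a).1⟩)) : f = g := by
  have hx : IsVirtualBraidLike (H := μ.ker) (fun i => ⟨σv n i, (hμ i).1⟩) (ρv n) := by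
    refine ⟨ρv_mul_self, fun i j h => Subtype.ext (σv_braid h), fun i j h => Subtype.ext ?_⟩
    rw [MulAut.conjNormal_apply, ρv_mul_ρv_mul_σv h]
    simp [mul_assoc]
  exact hx.hom_ext closure_range_σv_union_range_ρv
    (hμ.ker_le_normalClosure (by have := a.2; omega)) h₁ h₂

section WreathRepresentation

variable (n) in
/-- The semidirect product of the functions on ordered pairs of strands by the symmetric group. -/
abbrev PairWreath : Type :=
  (Fin n × Fin n → Multiplicative (ZMod 2)) ⋊[mulAutArrow] Equiv.Perm (Fin n)

/-- The indicator function of an ordered pair of strands. -/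
def pairIndicator (a b : Fin n) : Fin n × Fin n → Multiplicative (ZMod 2) :=
  fun q => if q = (a, b) then Multiplicative.ofAdd 1 else 1

lemma mulAutArrow_pairIndicator (g : Equiv.Perm (Fin n)) (a b : Fin n) :
    mulAutArrow g (pairIndicator a b) = pairIndicator (g a) (g b) := by
  funext q
  change pairIndicator a b (g⁻¹ • q) = _
  have : g⁻¹ • q = (a, b) ↔ q = (g a, g b) := by rw [inv_smul_eq_iff]; rfl
  simp only [pairIndicator, this]

/-- The smaller strand moved by `sw n i`. -/
def lowStrand (i : Fin (n - 1)) : Fin n := ⟨i, by omega⟩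

/-- The larger strand moved by `sw n i`. -/
def highStrand (i : Fin (n - 1)) : Fin n := ⟨i + 1, by omega⟩

lemma sw_eq_swap (i : Fin (n - 1)) : sw n i = Equiv.swap (lowStrand i) (highStrand i) := rfl

/-- The images of the generators of `VB n` in `PairWreath n`. -/
def pairWreathGen : Fin (n - 1) ⊕ Fin (n - 1) → PairWreath n
  | .inl i => ⟨pairIndicator (lowStrand i) (highStrand i), sw n i⟩
  | .inr i => ⟨1, sw n i⟩

lemma sw_mul_self (i : Fin (n - 1)) : sw n i * sw n i = 1 := by
  simp [sw_eq_swap]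

lemma sw_low_of_far {i j : Fin (n - 1)} (h : (i : ℕ) + 2 ≤ j ∨ (j : ℕ) + 2 ≤ i) :
    sw n i (lowStrand j) = lowStrand j :=
  Equiv.swap_apply_of_ne_of_ne (by simp [lowStrand, Fin.ext_iff]; omega)
    (by simp [lowStrand, Fin.ext_iff]; omega)

lemma sw_high_of_far {i j : Fin (n - 1)} (h : (i : ℕ) + 2 ≤ j ∨ (j : ℕ) + 2 ≤ i) :
    sw n i (highStrand j) = highStrand j :=
  Equiv.swap_apply_of_ne_of_ne (by simp [highStrand, Fin.ext_iff]; omega)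
    (by simp [highStrand, Fin.ext_iff]; omega)

lemma sw_low (i : Fin (n - 1)) : sw n i (lowStrand i) = highStrand i := Equiv.swap_apply_left _ _

lemma sw_high (i : Fin (n - 1)) : sw n i (highStrand i) = lowStrand i := Equiv.swap_apply_right _ _

lemma lowStrand_succ {i j : Fin (n - 1)} (h : (i : ℕ) + 1 = j) : lowStrand j = highStrand i :=
  Fin.ext h.symm

lemma sw_high_succ {i j : Fin (n - 1)} (h : (i : ℕ) + 1 = j) :
    sw n i (highStrand j) = highStrand j :=
  Equiv.swap_apply_of_ne_of_ne (by simp [highStrand, Fin.ext_iff]; omega)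
    (by simp [highStrand, Fin.ext_iff]; omega)

lemma sw_succ_low {i j : Fin (n - 1)} (h : (i : ℕ) + 1 = j) :
    sw n j (lowStrand i) = lowStrand i :=
  Equiv.swap_apply_of_ne_of_ne (by simp [lowStrand, Fin.ext_iff]; omega)
    (by simp [lowStrand, Fin.ext_iff]; omega)

lemma sw_inv (i : Fin (n - 1)) : (sw n i)⁻¹ = sw n i := inv_eq_of_mul_eq_one_right (sw_mul_self i)

lemma sw_comm {i j : Fin (n - 1)} (h : (i : ℕ) + 2 ≤ j ∨ (j : ℕ) + 2 ≤ i) :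
    sw n i * sw n j = sw n j * sw n i := by
  have := Equiv.swap_apply_apply (sw n i) (lowStrand j) (highStrand j)
  rw [sw_low_of_far h, sw_high_of_far h, ← sw_eq_swap] at this
  exact (eq_mul_inv_iff_mul_eq.1 this).symm

lemma sw_braid {i j : Fin (n - 1)} (h : (i : ℕ) + 1 = j) :
    sw n i * sw n j * sw n i = sw n j * sw n i * sw n j := by
  have h₁ := Equiv.swap_apply_apply (sw n i) (lowStrand j) (highStrand j)
  have h₂ := Equiv.swap_apply_apply (sw n j) (lowStrand i) (highStrand i)
  rw [lowStrand_succ h, sw_high, sw_high_succ h, ← lowStrand_succ h, ← sw_eq_swap, sw_inv] at h₁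
  rw [sw_succ_low h, ← lowStrand_succ h, sw_low, lowStrand_succ h, ← sw_eq_swap, sw_inv] at h₂
  exact h₁.symm.trans h₂

lemma lift_pairWreathGen_eq_one : ∀ r ∈ vbRels n, FreeGroup.lift pairWreathGen r = 1 := by
  have hσ : ∀ i, FreeGroup.lift pairWreathGen (σg n i) = pairWreathGen (.inl i) := fun i =>
    FreeGroup.lift_apply_of
  have hρ : ∀ i, FreeGroup.lift pairWreathGen (ρg n i) = pairWreathGen (.inr i) := fun i =>
    FreeGroup.lift_apply_of
  rintro r ⟨i, j, h | h | h | h | h | h | h⟩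
  · obtain ⟨h, rfl⟩ := h
    rw [map_mul, map_inv, mul_inv_eq_one]
    have h₁ := sw_succ_low h
    have h₂ := sw_high_succ h
    have h₃ := sw_low j
    have h₄ := sw_high j
    rw [lowStrand_succ h] at h₃ h₄
    simp only [map_mul, hσ, pairWreathGen]
    refine SemidirectProduct.ext ?_ (sw_braid h)
    simp only [SemidirectProduct.mul_left, SemidirectProduct.mul_right, mulAutArrow_pairIndicator,
      Equiv.Perm.mul_apply, lowStrand_succ h, h₁, h₂, h₃, h₄, sw_low, sw_high]
    rw [mul_comm, mul_comm (pairIndicator (lowStrand i) _), mul_assoc]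
  · obtain ⟨h, rfl⟩ := h
    rw [map_mul, map_inv, mul_inv_eq_one]
    simp only [map_mul, hσ, pairWreathGen]
    refine SemidirectProduct.ext ?_ (sw_comm h)
    simp only [SemidirectProduct.mul_left, mulAutArrow_pairIndicator, sw_low_of_far h,
      sw_high_of_far h, sw_low_of_far h.symm, sw_high_of_far h.symm]
    exact mul_comm _ _
  · obtain ⟨h, rfl⟩ := h
    rw [map_mul, map_inv, mul_inv_eq_one]
    simp only [map_mul, hρ, pairWreathGen]
    refine SemidirectProduct.ext ?_ (sw_braid h)
    simp [SemidirectProduct.mul_left]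
  · obtain ⟨h, rfl⟩ := h
    rw [map_mul, map_inv, mul_inv_eq_one]
    simp only [map_mul, hρ, pairWreathGen]
    refine SemidirectProduct.ext ?_ (sw_comm h)
    simp [SemidirectProduct.mul_left]
  · subst h
    simp only [map_mul, hρ, pairWreathGen]
    refine SemidirectProduct.ext ?_ (sw_mul_self i)
    simp [SemidirectProduct.mul_left]
  · obtain ⟨h, rfl⟩ := h
    rw [map_mul, map_inv, mul_inv_eq_one]
    simp only [map_mul, hσ, hρ, pairWreathGen]
    refine SemidirectProduct.ext ?_ (sw_comm h)
    simp only [SemidirectProduct.mul_left, mulAutArrow_pairIndicator, map_one, one_mul, mul_one,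
      sw_low_of_far h.symm, sw_high_of_far h.symm]
  · obtain ⟨h, rfl⟩ := h
    rw [map_mul, map_inv, mul_inv_eq_one]
    have h₁ := sw_succ_low h
    have h₂ := sw_high_succ h
    have h₃ := sw_low j
    rw [lowStrand_succ h] at h₃
    simp only [map_mul, hσ, hρ, pairWreathGen]
    refine SemidirectProduct.ext ?_ (sw_braid h)
    simp only [SemidirectProduct.mul_left, SemidirectProduct.mul_right, mulAutArrow_pairIndicator,
      Equiv.Perm.mul_apply, lowStrand_succ h, h₁, h₂, h₃, sw_low, map_one, one_mul, mul_one]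

/-- The representation of the virtual braid group in `PairWreath n`. -/
def toPairWreath : VB n →* PairWreath n := PresentedGroup.toGroup lift_pairWreathGen_eq_one

lemma toPairWreath_σv (i : Fin (n - 1)) :
    toPairWreath (σv n i) = ⟨pairIndicator (lowStrand i) (highStrand i), sw n i⟩ :=
  PresentedGroup.toGroup.of _

lemma toPairWreath_ρv (i : Fin (n - 1)) : toPairWreath (ρv n i) = ⟨1, sw n i⟩ :=
  PresentedGroup.toGroup.of _

lemma IsNu.toPairWreath_right {ν : VB n →* Equiv.Perm (Fin n)} (hν : IsNu n ν) (y : VB n) :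
    (toPairWreath y).right = ν y := by
  suffices h : SemidirectProduct.rightHom.comp toPairWreath = ν from DFunLike.congr_fun h y
  refine PresentedGroup.ext ?_
  rintro (i | i)
  · exact (congrArg SemidirectProduct.right (toPairWreath_σv i)).trans (hν i).1.symm
  · exact (congrArg SemidirectProduct.right (toPairWreath_ρv i)).trans (hν i).2.symm

/-- The homomorphism from the virtual pure braid group to the functions on ordered pairs of
strands. -/
def IsNu.pairHom {ν : VB n →* Equiv.Perm (Fin n)} (hν : IsNu n ν) :
    ν.ker →* (Fin n × Fin n → Multiplicative (ZMod 2)) where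
  toFun y := (toPairWreath (y : VB n)).left
  map_one' := by simp
  map_mul' y z := by
    have : ν y = 1 := y.2
    simp [SemidirectProduct.mul_left, hν.toPairWreath_right, this]

lemma IsNu.exists_pairHom_eq {ν : VB n →* Equiv.Perm (Fin n)} (hν : IsNu n ν) (i : Fin (n - 1)) :
    (∃ y, hν.pairHom y = pairIndicator (lowStrand i) (highStrand i)) ∧
      ∃ y, hν.pairHom y = pairIndicator (highStrand i) (lowStrand i) := by
  have hsq := sw_mul_self i
  refine ⟨⟨⟨σv n i * ρv n i, ?_⟩, ?_⟩, ⟨⟨ρv n i * σv n i, ?_⟩, ?_⟩⟩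
  · simp [MonoidHom.mem_ker, (hν i).1, (hν i).2, hsq]
  · simp [IsNu.pairHom, SemidirectProduct.mul_left, toPairWreath_σv, toPairWreath_ρv]
  · simp [MonoidHom.mem_ker, (hν i).1, (hν i).2, hsq]
  · simp [IsNu.pairHom, SemidirectProduct.mul_left, toPairWreath_σv, toPairWreath_ρv,
      mulAutArrow_pairIndicator, sw_low, sw_high]

/-- The virtual pure braid group has at least five homomorphisms to a group of order two. -/
lemma IsNu.exists_injective_hom {ν : VB n →* Equiv.Perm (Fin n)} (hν : IsNu n ν) (hn : 3 ≤ n) :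
    ∃ F : Option (Fin 2 × Bool) → (ν.ker →* Multiplicative (ZMod 2)), Function.Injective F := by
  let c (t : Fin 2 × Bool) : Fin (n - 1) := ⟨t.1, by omega⟩
  let q (t : Fin 2 × Bool) : Fin n × Fin n :=
    if t.2 then (lowStrand (c t), highStrand (c t)) else (highStrand (c t), lowStrand (c t))
  have hq : Function.Injective q := by
    rintro ⟨i, b⟩ ⟨j, d⟩ h
    cases b <;> cases d <;> simp [q, c, lowStrand, highStrand, Fin.ext_iff] at h ⊢ <;> omega
  have hy : ∀ t, ∃ y, hν.pairHom y = pairIndicator (q t).1 (q t).2 := by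
    rintro ⟨i, b⟩
    cases b
    · exact (hν.exists_pairHom_eq _).2
    · exact (hν.exists_pairHom_eq _).1
  choose y hy using hy
  let F : Option (Fin 2 × Bool) → (ν.ker →* Multiplicative (ZMod 2)) := fun o =>
    o.elim 1 fun t => (Pi.evalMonoidHom _ (q t)).comp hν.pairHom
  have hF : ∀ o t, F o (y t) = if o = some t then Multiplicative.ofAdd 1 else 1 := by
    rintro (_ | u) t
    · simp [F]
    · simp [F, hy, pairIndicator, hq.eq_iff]
  have hone : (Multiplicative.ofAdd 1 : Multiplicative (ZMod 2)) ≠ 1 := by decide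
  have key : ∀ o t, F o = F (some t) → o = some t := by
    intro o t h
    by_contra hne
    have := DFunLike.congr_fun h (y t)
    rw [hF, hF, if_neg hne, if_pos rfl] at this
    exact hone this.symm
  refine ⟨F, ?_⟩
  rintro o (_ | t) h
  · rcases o with _ | u
    · rfl
    · exact (key _ _ h.symm).symm
  · exact key _ _ h

end WreathRepresentation

end VirtualBraid

/-- For every `n ≥ 3`, the groups `H_n = ker μ` and `VP_n = ker ν` are
not isomorphic. -/
theorem hn_not_iso_vpn (n : ℕ) (hn : 3 ≤ n)
    (μ : VB n →* Equiv.Perm (Fin n)) (hμ : IsMu n μ)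
    (ν : VB n →* Equiv.Perm (Fin n)) (hν : IsNu n ν) :
    IsEmpty (↥μ.ker ≃* ↥ν.ker) := by
  refine ⟨fun e => ?_⟩
  obtain ⟨F, hF⟩ := hν.exists_injective_hom hn
  let a : Fin (n - 1) := ⟨0, by omega⟩
  let x : μ.ker := ⟨σv n a, (hμ a).1⟩
  let E : Option (Fin 2 × Bool) → Multiplicative (ZMod 2) × Multiplicative (ZMod 2) := fun o =>
    (F o (e x), F o (e (MulAut.conjNormal (ρv n a) x)))
  have hE : Function.Injective E := by
    intro o o' h
    have h := Prod.ext_iff.1 h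
    have hcomp : (F o).comp e.toMonoidHom = (F o').comp e.toMonoidHom :=
      hμ.hom_ext a h.1 h.2
    refine hF (MonoidHom.ext fun y => ?_)
    simpa using DFunLike.congr_fun hcomp (e.symm y)
  have := Fintype.card_le_of_injective E hE
  simp [ZMod.card] at this
end

section
/- For every n ≥ 2, let M_n = S_n ⋊_φ S_n be the semidirect product of the symmetric group S_n with itself via the conjugation action φ, and let χ : VB_n → M_n be the homomorphism defined by χ(σ_i) = ((i, i+1), 1) and χ(ρ_i) = (1, (i, i+1)) for i = 1, …, n−1. Let η_1 : M_n → S_n be the projection (a, c) ↦ c and let η_2 : M_n → S_n be the multiplication map (a, c) ↦ a·c (a homomorphism since φ is conjugation). Then: (i) the kernel of η_1 ∘ χ equals H_n; (ii) the kernel of η_2 ∘ χ equals VP_n; and (iii) the kernel of χ equals H_n ∩ VP_n. -/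
/-- The semidirect product of a group with itself under conjugation is isomorphic to the direct
product, through `(a, c) ↦ (a * c, c)`. -/
def SemidirectProduct.conjEquivProd (G : Type*) [Group G] : G ⋊[MulAut.conj] G ≃* G × G where
  toFun x := (x.left * x.right, x.right)
  invFun p := ⟨p.1 * p.2⁻¹, p.2⟩
  left_inv x := by ext <;> simp
  right_inv p := by ext <;> simp
  map_mul' x y := by ext <;> simp [mul_assoc]

/-- Let `M_n = S_n ⋊ S_n` (conjugation action) and let `χ : VB_n → M_n` be
the homomorphism with `χ(σ_i) = ((i,i+1), 1)` and `χ(ρ_i) = (1, (i,i+1))`. With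
`η₁ : M_n → S_n` the projection `(a,c) ↦ c` and `η₂ : M_n → S_n` the multiplication map
`(a,c) ↦ a·c`, one has: (i) `ker (η₁ ∘ χ) = H_n = ker μ`; (ii) `ker (η₂ ∘ χ) = VP_n = ker ν`;
(iii) `ker χ = H_n ∩ VP_n`. -/
theorem kernels_of_chi (n : ℕ) (hn : 2 ≤ n)
    (μ : VB n →* Equiv.Perm (Fin n)) (hμ : IsMu n μ)
    (ν : VB n →* Equiv.Perm (Fin n)) (hν : IsNu n ν) :
    ∃ χ : VB n →* (Equiv.Perm (Fin n) ⋊[MulAut.conj] Equiv.Perm (Fin n)),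
      (∀ i : Fin (n-1), χ (σv n i) = ⟨sw n i, 1⟩ ∧ χ (ρv n i) = ⟨1, sw n i⟩) ∧
      (SemidirectProduct.rightHom.comp χ).ker = μ.ker ∧
      (∀ η₂ : (Equiv.Perm (Fin n) ⋊[MulAut.conj] Equiv.Perm (Fin n)) →* Equiv.Perm (Fin n),
        (∀ a c : Equiv.Perm (Fin n), η₂ ⟨a, c⟩ = a * c) → (η₂.comp χ).ker = ν.ker) ∧
      χ.ker = μ.ker ⊓ ν.ker := by
  set e := SemidirectProduct.conjEquivProd (Equiv.Perm (Fin n))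
  have key (a c : Equiv.Perm (Fin n)) : e.symm (a, c) = ⟨a * c⁻¹, c⟩ := rfl
  refine ⟨e.symm.toMonoidHom.comp (ν.prod μ), fun i => ?_, ?_, fun η₂ hη₂ => ?_, ?_⟩
  · obtain ⟨hμσ, hμρ⟩ := hμ i
    obtain ⟨hνσ, hνρ⟩ := hν i
    constructor <;> ext1 <;> simp [key, hμσ, hμρ, hνσ, hνρ]
  · ext g
    simp [key]
  · ext g
    simp [key, hη₂]
  · ext g
    simp [and_comm]
end
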